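/- As n → ∞, the empirical root measures μ_{N_n} of the rank principal polynomials N_n(w) converge weakly to ν, the uniform probability measure on the unit circle; that is, the roots of N_n(w) tend to equidistribution on the unit circle. -/

import Mathlib

open Finset MeasureTheory Filter

/-- The empirical root measure `μ_f = (1/d) ∑_{j=1}^{d} δ_{z_j}` of a polynomial `f` of
degree `d` with roots `z₁,…,z_d ∈ ℂ` listed with multiplicity. -/
noncomputable def rootMeasure (f : Polynomial ℂ) : Measure ℂ :=
  ((f.natDegree : ENNReal))⁻¹ • (f.roots.map MeasureTheory.Measure.dirac).sum

/-- The uniform (Haar) probability measure `ν` on the unit circle `{z ∈ ℂ : |z| = 1}`. -/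
noncomputable def circleUniform : Measure ℂ :=
  (ENNReal.ofReal (2 * Real.pi))⁻¹ •
    Measure.map (fun θ : ℝ => Complex.exp (θ * Complex.I))
      (volume.restrict (Set.Ioc (0 : ℝ) (2 * Real.pi)))

/-- The rank of a partition: its largest part minus its number of parts. -/
def partitionRank {n : ℕ} (π : Nat.Partition n) : ℤ :=
  (π.parts.sup : ℤ) - Multiset.card π.parts

/-- `N(m,n)`: the number of partitions of `n` with rank `m`. -/
noncomputable def rankCount (m : ℤ) (n : ℕ) : ℕ :=
  Nat.card {π : Nat.Partition n // partitionRank π = m}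

/-- The rank principal polynomial `N_n(w) = N(0,n)/2 + ∑_{1 ≤ m < n} N(m,n) wᵐ`. -/
noncomputable def rankPrincipal (n : ℕ) : Polynomial ℂ :=
  Polynomial.C ((rankCount 0 n : ℂ) / 2) +
    ∑ m ∈ Finset.Ico 1 n, Polynomial.C ((rankCount m n : ℕ) : ℂ) * Polynomial.X ^ m

/-- The iterated derivatives of `z ↦ log (1 - a z)` on the unit disc. -/
lemma iteratedDeriv_log_one_sub_mul {a : ℂ} (ha : ‖a‖ ≤ 1) (k : ℕ) :
    ∀ z : ℂ, ‖z‖ < 1 → iteratedDeriv (k + 1) (fun z => Complex.log (1 - a * z)) z =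
      -(k.factorial * a ^ (k + 1)) * (1 - a * z) ^ (-(k + 1 : ℤ)) := by
  have hslit : ∀ z : ℂ, ‖z‖ < 1 → 1 - a * z ∈ Complex.slitPlane := fun z hz => by
    rw [sub_eq_add_neg]
    apply Complex.mem_slitPlane_of_norm_lt_one
    rw [norm_neg, norm_mul]
    nlinarith [norm_nonneg a, norm_nonneg z]
  have hlin : ∀ z : ℂ, HasDerivAt (fun z : ℂ => 1 - a * z) (-a) z := fun z => by
    simpa using ((hasDerivAt_id z).const_mul a).const_sub 1
  induction k with
  | zero =>
    intro z hz
    rw [zero_add, iteratedDeriv_one, ((hlin z).clog (hslit z hz)).deriv]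
    simp [div_eq_mul_inv]
  | succ k ih =>
    intro z hz
    have hev : iteratedDeriv (k + 1) (fun z => Complex.log (1 - a * z)) =ᶠ[nhds z]
        fun z => -(k.factorial * a ^ (k + 1)) * (1 - a * z) ^ (-(k + 1 : ℤ)) := by
      filter_upwards [(isOpen_lt continuous_norm continuous_const).mem_nhds hz] with w hw
      exact ih w hw
    have hne := Complex.slitPlane_ne_zero (hslit z hz)
    rw [iteratedDeriv_succ, hev.deriv_eq]
    have := (((hasDerivAt_zpow (-(k + 1 : ℤ)) (1 - a * z) (Or.inl hne)).comp z
      (hlin z)).const_mul (-(k.factorial * a ^ (k + 1) : ℂ))).deriv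
    simp only [Function.comp_def] at this
    rw [this, Nat.factorial_succ, show (-((k + 1 : ℕ) + 1 : ℤ)) = -(k + 1 : ℤ) - 1 by push_cast; ring]
    push_cast
    ring

/-- If a product `∏ (1 - uᵢ w)` with `|uᵢ| ≤ 1` is bounded by `exp A` on the unit circle, then
each power sum of the `uᵢ` is bounded by a constant times `A`. -/
lemma norm_sum_pow_le_of_norm_prod_le {ι : Type*} (s : Finset ι) (u : ι → ℂ)
    (hu : ∀ i, ‖u i‖ ≤ 1) {A : ℝ} (hA : 0 < A)
    (hb : ∀ w : ℂ, ‖w‖ = 1 → ‖∏ i ∈ s, (1 - u i * w)‖ ≤ Real.exp A) (k : ℕ) :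
    ‖∑ i ∈ s, u i ^ (k + 1)‖ ≤ (k + 1) * 2 ^ (k + 2) * A := by
  have hslit : ∀ i, ∀ z : ℂ, ‖z‖ < 1 → 1 - u i * z ∈ Complex.slitPlane := fun i z hz => by
    rw [sub_eq_add_neg]
    apply Complex.mem_slitPlane_of_norm_lt_one
    rw [norm_neg, norm_mul]
    nlinarith [norm_nonneg (u i), norm_nonneg z, hu i]
  set h : ℂ → ℂ := fun z => ∑ i ∈ s, Complex.log (1 - u i * z) with hh
  have hball : ∀ z : ℂ, ‖z‖ ≤ 1 → ‖∏ i ∈ s, (1 - u i * z)‖ ≤ Real.exp A := by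
    intro z hz
    refine Complex.norm_le_of_forall_mem_frontier_norm_le (U := Metric.ball (0 : ℂ) 1)
      (f := fun z => ∏ i ∈ s, (1 - u i * z)) Metric.isBounded_ball
      (Differentiable.diffContOnCl (by fun_prop)) (fun w hw => hb w ?_) ?_
    · simpa [frontier_ball] using hw
    · simpa [closure_ball] using hz
  have hdiff : DifferentiableOn ℂ h (Metric.ball 0 1) := by
    intro z hz
    refine DifferentiableAt.differentiableWithinAt ?_
    refine DifferentiableAt.fun_sum fun i _ => ?_
    exact DifferentiableAt.clog (by fun_prop) (hslit i z (by simpa using hz))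
  have hre : Set.MapsTo h (Metric.ball 0 1) {z | z.re ≤ A} := by
    intro z hz
    have hz' : ‖z‖ < 1 := by simpa using hz
    have : Complex.exp (h z) = ∏ i ∈ s, (1 - u i * z) := by
      rw [hh, Complex.exp_sum]
      exact prod_congr rfl fun i _ => Complex.exp_log (Complex.slitPlane_ne_zero (hslit i z hz'))
    have h2 := hball z hz'.le
    rw [← this, Complex.norm_exp] at h2
    exact Real.exp_le_exp.mp h2
  have hbound : ∀ z ∈ Metric.sphere (0 : ℂ) (1 / 2), ‖h z‖ ≤ 2 * A := by
    intro z hz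
    have hz' : ‖z‖ = 1 / 2 := by simpa using hz
    have := Complex.borelCaratheodory_zero hA hdiff hre one_pos
      (z := z) (by rw [mem_ball_zero_iff, hz']; norm_num) (by simp [hh])
    rw [hz'] at this
    norm_num at this
    exact this
  have hsub : Metric.closedBall (0 : ℂ) (1 / 2) ⊆ Metric.ball 0 1 :=
    Metric.closedBall_subset_ball (by norm_num)
  have hC := Complex.norm_iteratedDeriv_le_of_forall_mem_sphere_norm_le (k + 1)
    (by norm_num : (0 : ℝ) < 1 / 2) ((hdiff.mono hsub).diffContOnCl_ball subset_rfl) hbound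
  have hid : iteratedDeriv (k + 1) h 0 = -(k.factorial * ∑ i ∈ s, u i ^ (k + 1)) := by
    rw [hh, iteratedDeriv_fun_sum]
    · rw [mul_sum, ← sum_neg_distrib]
      refine sum_congr rfl fun i _ => ?_
      rw [iteratedDeriv_log_one_sub_mul (hu i) k 0 (by simp)]
      simp
    · intro i _
      exact AnalyticAt.contDiffAt (AnalyticAt.clog (f := fun z => 1 - u i * z) (by fun_prop)
        (hslit i 0 (by simp)))
  rw [hid, norm_neg, norm_mul, Complex.norm_natCast, Nat.factorial_succ] at hC
  have hk : (0 : ℝ) < k.factorial := by positivity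
  refine le_of_mul_le_mul_left (hC.trans_eq ?_) hk
  push_cast
  rw [div_pow, one_pow]
  field_simp
  ring

/-- Moving a nonzero complex number radially onto the unit circle, comparing the distances to
points of the circle. -/
lemma norm_sub_div_norm_sq_mul_le {v z : ℂ} (hv : ‖v‖ = 1) (hz : z ≠ 0) :
    ‖v - z / ‖z‖‖ ^ 2 * ‖z‖ ≤ ‖v - z‖ ^ 2 := by
  have hr : (0 : ℝ) < ‖z‖ := norm_pos_iff.mpr hz
  obtain ⟨u, hu, huz⟩ : ∃ u : ℂ, z / ‖z‖ = u ∧ z = ‖z‖ • u :=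
    ⟨_, rfl, by
      rw [Complex.real_smul, mul_div_cancel₀ _ (Complex.ofReal_ne_zero.mpr hr.ne')]⟩
  have hun : ‖u‖ = 1 := by rw [← hu]; simp [hr.ne']
  rw [hu]
  generalize ‖z‖ = r at *
  subst huz
  rw [norm_sub_sq_real, norm_sub_sq_real, real_inner_smul_right, norm_smul, hv, hun,
    Real.norm_eq_abs, abs_of_pos hr]
  nlinarith [sq_nonneg (r - 1)]

lemma abs_log_eq_log_max_one_sq_div {x : ℝ} (hx : 0 < x) :
    |Real.log x| = Real.log (max 1 x ^ 2 / x) := by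
  rcases le_total 1 x with h | h
  · rw [max_eq_right h, abs_of_nonneg (Real.log_nonneg h)]
    congr 1
    field_simp
  · rw [max_eq_left h, abs_of_nonpos (Real.log_nonpos hx.le h)]
    simp

namespace Polynomial

lemma exists_roots_eq_map_fin (P : Polynomial ℂ) :
    ∃ z : Fin P.natDegree → ℂ, P.roots = (Finset.univ.val.map z) := by
  have hcard : P.roots.toList.length = P.natDegree := by
    rw [Multiset.length_toList, (IsAlgClosed.splits P).natDegree_eq_card_roots]
  refine ⟨fun i => P.roots.toList.get (i.cast hcard.symm), ?_⟩
  conv_lhs => rw [← P.roots.coe_toList]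
  generalize P.roots.toList = l at hcard
  generalize P.natDegree = d at hcard
  subst hcard
  simp

/-- The quantity `L(P)² / (|P(0)| |lc P|)`, where `L(P)` is the sum of the absolute values of the
coefficients of `P`, which controls the distribution of the roots of `P` near the unit circle. -/
noncomputable def erdosTuranHeight (P : Polynomial ℂ) : ℝ :=
  (P.sum fun _ a => ‖a‖) ^ 2 / (‖P.coeff 0‖ * ‖P.leadingCoeff‖)

variable {P : Polynomial ℂ} {z : Fin P.natDegree → ℂ}

lemma ne_zero_of_roots_eq_map (h0 : P.coeff 0 ≠ 0) (hz : P.roots = Finset.univ.val.map z)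
    (i : Fin P.natDegree) : z i ≠ 0 := by
  have hP : P ≠ 0 := fun h => by simp [h] at h0
  have hi : z i ∈ P.roots := by rw [hz]; simp
  intro h
  rw [h, mem_roots hP, IsRoot, ← coeff_zero_eq_eval_zero] at hi
  exact h0 hi

lemma norm_coeff_zero_eq_mul_prod (hz : P.roots = Finset.univ.val.map z) :
    ‖P.coeff 0‖ = ‖P.leadingCoeff‖ * ∏ i, ‖z i‖ := by
  rw [(IsAlgClosed.splits P).coeff_zero_eq_leadingCoeff_mul_prod_roots, hz, norm_mul, norm_mul,
    Finset.prod_map_val, norm_prod]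
  simp

lemma prod_le_erdosTuranHeight (h0 : P.coeff 0 ≠ 0) (hz : P.roots = Finset.univ.val.map z)
    {b : ℝ} (hb0 : 0 ≤ b) (hb : ‖P.leadingCoeff‖ * b ≤ P.sum fun _ a => ‖a‖) :
    b ^ 2 / ∏ i, ‖z i‖ ≤ P.erdosTuranHeight := by
  have hP : P ≠ 0 := fun h => by simp [h] at h0
  have hl : 0 < ‖P.leadingCoeff‖ := norm_pos_iff.mpr (leadingCoeff_ne_zero.mpr hP)
  have hp : 0 < ∏ i, ‖z i‖ :=
    prod_pos fun i _ => norm_pos_iff.mpr (ne_zero_of_roots_eq_map h0 hz i)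
  rw [erdosTuranHeight, norm_coeff_zero_eq_mul_prod hz]
  calc b ^ 2 / ∏ i, ‖z i‖
      = (‖P.leadingCoeff‖ * b) ^ 2 / (‖P.leadingCoeff‖ * (∏ i, ‖z i‖) * ‖P.leadingCoeff‖) := by
        field_simp
    _ ≤ _ := by gcongr

lemma sum_abs_log_norm_roots_le (h0 : P.coeff 0 ≠ 0) (hz : P.roots = Finset.univ.val.map z) :
    ∑ i, |Real.log ‖z i‖| ≤ Real.log P.erdosTuranHeight := by
  have hpos : ∀ i, 0 < ‖z i‖ := fun i => norm_pos_iff.mpr (ne_zero_of_roots_eq_map h0 hz i)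
  have hmax : ∀ i, 0 < max 1 ‖z i‖ := fun i => lt_max_of_lt_left one_pos
  simp_rw [fun i => abs_log_eq_log_max_one_sq_div (hpos i)]
  rw [← Real.log_prod fun i _ => (div_pos (pow_pos (hmax i) 2) (hpos i)).ne']
  refine Real.log_le_log (prod_pos fun i _ => div_pos (pow_pos (hmax i) 2) (hpos i)) ?_
  rw [prod_div_distrib, prod_pow]
  refine prod_le_erdosTuranHeight h0 hz (prod_nonneg fun i _ => (hmax i).le) ?_
  have := P.mahlerMeasure_le_sum_norm_coeff
  rwa [mahlerMeasure_eq_leadingCoeff_mul_prod_roots, hz, Multiset.map_map] at this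

lemma log_erdosTuranHeight_nonneg (h0 : P.coeff 0 ≠ 0) : 0 ≤ Real.log P.erdosTuranHeight := by
  obtain ⟨z, hz⟩ := P.exists_roots_eq_map_fin
  exact (sum_nonneg fun _ _ => abs_nonneg _).trans (sum_abs_log_norm_roots_le h0 hz)

lemma erdosTuranHeight_pos (h0 : P.coeff 0 ≠ 0) : 0 < P.erdosTuranHeight := by
  have hP : P ≠ 0 := fun h => by simp [h] at h0
  have hl : 0 < ‖P.leadingCoeff‖ := norm_pos_iff.mpr (leadingCoeff_ne_zero.mpr hP)
  have hsum : 0 < P.sum fun _ a => ‖a‖ :=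
    hl.trans_le (P.leadingCoeff_le_mahlerMeasure.trans P.mahlerMeasure_le_sum_norm_coeff)
  exact div_pos (pow_pos hsum 2) (mul_pos (norm_pos_iff.mpr h0) hl)

lemma norm_prod_one_sub_sq_le (h0 : P.coeff 0 ≠ 0) (hz : P.roots = Finset.univ.val.map z)
    {w : ℂ} (hw : ‖w‖ = 1) :
    ‖∏ i, (1 - z i / ‖z i‖ * w)‖ ^ 2 ≤ P.erdosTuranHeight := by
  have hw0 : w ≠ 0 := fun h => by simp [h] at hw
  have hv : ‖w⁻¹‖ = 1 := by rw [norm_inv, hw, inv_one]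
  have hpos : ∀ i, 0 < ‖z i‖ := fun i => norm_pos_iff.mpr (ne_zero_of_roots_eq_map h0 hz i)
  have hrot : ∀ i, ‖1 - z i / ‖z i‖ * w‖ = ‖w⁻¹ - z i / ‖z i‖‖ := fun i => by
    rw [show 1 - z i / ‖z i‖ * w = (w⁻¹ - z i / ‖z i‖) * w by field_simp, norm_mul, hw, mul_one]
  have heval : ‖P.leadingCoeff‖ * ∏ i, ‖w⁻¹ - z i‖ ≤ P.sum fun _ a => ‖a‖ := by
    have : ‖P.eval w⁻¹‖ = ‖P.leadingCoeff‖ * ∏ i, ‖w⁻¹ - z i‖ := by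
      rw [(IsAlgClosed.splits P).eval_eq_prod_roots, hz, norm_mul, ← norm_prod,
        Multiset.map_map]
      rfl
    rw [← this, eval_eq_sum]
    refine (norm_sum_le _ _).trans_eq (sum_congr rfl fun k _ => ?_)
    rw [norm_mul, norm_pow, hv, one_pow, mul_one]
  refine le_trans ?_ (prod_le_erdosTuranHeight h0 hz (prod_nonneg fun i _ => norm_nonneg _) heval)
  rw [le_div_iff₀ (prod_pos fun i _ => hpos i), norm_prod, ← prod_pow, ← prod_pow,
    ← prod_mul_distrib]
  refine prod_le_prod (fun i _ => by positivity) fun i _ => ?_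
  rw [hrot]
  exact norm_sub_div_norm_sq_mul_le hv (norm_pos_iff.mp (hpos i))

lemma norm_sum_pow_normalized_roots_le (h0 : P.coeff 0 ≠ 0)
    (hz : P.roots = Finset.univ.val.map z) (k : ℕ) :
    ‖∑ i, (z i / ‖z i‖) ^ (k + 1)‖ ≤ (k + 1) * 2 ^ (k + 2) * (Real.log P.erdosTuranHeight + 1) := by
  have hlog := log_erdosTuranHeight_nonneg h0
  refine norm_sum_pow_le_of_norm_prod_le Finset.univ (fun i => z i / ‖z i‖) (fun i => ?_)
    (by positivity) (fun w hw => ?_) k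
  · simp only [norm_div, Complex.norm_real, norm_norm]
    exact div_self_le_one _
  · refine le_of_sq_le_sq ((norm_prod_one_sub_sq_le h0 hz hw).trans ?_) (Real.exp_pos _).le
    rw [← Real.exp_nat_mul]
    nth_rewrite 1 [← Real.exp_log (erdosTuranHeight_pos h0)]
    refine Real.exp_le_exp.mpr ?_
    push_cast
    linarith

end Polynomial

open scoped BoundedContinuousFunction

/-- **Weyl's criterion** on the additive circle, for triangular arrays. -/
lemma tendsto_avg_of_tendsto_avg_fourier {T : ℝ} [Fact (0 < T)] {d : ℕ → ℕ}
    (x : ∀ n, Fin (d n) → AddCircle T) (hd : ∀ᶠ n in atTop, d n ≠ 0)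
    (h : ∀ k : ℤ, k ≠ 0 →
      Tendsto (fun n => (d n : ℂ)⁻¹ * ∑ i, fourier k (x n i)) atTop (nhds 0))
    (f : C(AddCircle T, ℂ)) :
    Tendsto (fun n => (d n : ℂ)⁻¹ * ∑ i, f (x n i)) atTop
      (nhds (∫ t, f t ∂AddCircle.haarAddCircle)) := by
  have hint : ∀ f : C(AddCircle T, ℂ), Integrable f AddCircle.haarAddCircle := fun f =>
    f.continuous.integrable_of_hasCompactSupport (HasCompactSupport.of_compactSpace f)
  have hspan : ∀ f ∈ Submodule.span ℂ (Set.range <| @fourier T),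
      Tendsto (fun n => (d n : ℂ)⁻¹ * ∑ i, f (x n i)) atTop
        (nhds (∫ t, f t ∂AddCircle.haarAddCircle)) := by
    intro f hf
    induction hf using Submodule.span_induction with
    | mem f hf =>
      obtain ⟨k, rfl⟩ := hf
      rcases eq_or_ne k 0 with rfl | hk
      · simp only [fourier_zero, integral_const, probReal_univ, one_smul]
        refine tendsto_const_nhds.congr' ?_
        filter_upwards [hd] with n hn
        simp [hn]
      · have hI : ∫ t, fourier k t ∂(AddCircle.haarAddCircle (T := T)) = 0 := by
          have := congr_fun (fourierCoeff_fourier (T := T) k) 0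
          rw [Pi.single_eq_of_ne hk.symm] at this
          simpa [fourierCoeff] using this
        rw [hI]
        exact h k hk
    | zero => simp
    | add f g _ _ hf hg =>
      simp only [ContinuousMap.add_apply, sum_add_distrib, mul_add]
      rw [integral_add (hint f) (hint g)]
      exact hf.add hg
    | smul c f _ hf =>
      simp only [ContinuousMap.smul_apply, smul_eq_mul, ← mul_sum]
      rw [integral_const_mul]
      refine (hf.const_mul c).congr fun n => by ring
  have hf : f ∈ closure (Submodule.span ℂ (Set.range <| @fourier T) : Set C(AddCircle T, ℂ)) := by
    rw [← Submodule.topologicalClosure_coe, span_fourier_closure_eq_top]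
    trivial
  rw [Metric.tendsto_nhds]
  intro ε hε
  obtain ⟨g, hg, hfg⟩ := Metric.mem_closure_iff.mp hf (ε / 3) (by positivity)
  rw [dist_eq_norm] at hfg
  filter_upwards [Metric.tendsto_nhds.mp (hspan g hg) (ε / 3) (by positivity)] with n hn
  have h1 : ‖(d n : ℂ)⁻¹ * ∑ i, f (x n i) - (d n : ℂ)⁻¹ * ∑ i, g (x n i)‖ ≤ ‖f - g‖ := by
    rw [← mul_sub, ← sum_sub_distrib, norm_mul, norm_inv, Complex.norm_natCast]
    calc (d n : ℝ)⁻¹ * ‖∑ i, (f (x n i) - g (x n i))‖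
        ≤ (d n : ℝ)⁻¹ * ∑ _i : Fin (d n), ‖f - g‖ := by
          gcongr
          exact norm_sum_le_of_le _ fun i _ => (f - g).norm_coe_le_norm (x n i)
      _ ≤ ‖f - g‖ := by
          rw [sum_const, card_univ, Fintype.card_fin, nsmul_eq_mul, ← mul_assoc]
          exact mul_le_of_le_one_left (norm_nonneg _) (inv_mul_le_one)
  have h2 : ‖∫ t, f t ∂AddCircle.haarAddCircle - ∫ t, g t ∂(AddCircle.haarAddCircle (T := T))‖
      ≤ ‖f - g‖ := by
    rw [← integral_sub (hint f) (hint g)]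
    refine (norm_integral_le_of_norm_le_const (C := ‖f - g‖)
      (Eventually.of_forall fun t => (f - g).norm_coe_le_norm t)).trans_eq ?_
    simp
  rw [dist_eq_norm] at hn ⊢
  calc _ = ‖((d n : ℂ)⁻¹ * ∑ i, f (x n i) - (d n : ℂ)⁻¹ * ∑ i, g (x n i))
        + ((d n : ℂ)⁻¹ * ∑ i, g (x n i) - ∫ t, g t ∂AddCircle.haarAddCircle)
        - (∫ t, f t ∂AddCircle.haarAddCircle - ∫ t, g t ∂AddCircle.haarAddCircle)‖ := by
          congr 1; ring
    _ ≤ _ := (norm_sub_le _ _).trans <| add_le_add_left (norm_add_le _ _) _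
    _ < ε := by linarith

/-- Radial projection to the unit circle changes a bounded continuous function by an amount
controlled by `|log |z||`. -/
lemma exists_abs_sub_div_norm_le (g : ℂ →ᵇ ℝ) {ε : ℝ} (hε : 0 < ε) :
    ∃ C : ℝ, 0 ≤ C ∧ ∀ z : ℂ, z ≠ 0 → |g z - g (z / ‖z‖)| ≤ ε + C * |Real.log ‖z‖| := by
  have huc := (isCompact_closedBall (0 : ℂ) 2).uniformContinuousOn_of_continuous
    g.continuous.continuousOn
  obtain ⟨δ, hδ, hg⟩ := Metric.uniformContinuousOn_iff.mp huc ε hε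
  set η := min δ 1
  have hη0 : 0 < η := lt_min hδ one_pos
  have hη1 : η ≤ 1 := min_le_right _ _
  refine ⟨2 * ‖g‖ / (η / 2), by positivity, fun z hz => ?_⟩
  have hr : 0 < ‖z‖ := norm_pos_iff.mpr hz
  have hunit : ‖z / ‖z‖‖ = 1 := by simp [hr.ne']
  by_cases hclose : |‖z‖ - 1| < η
  · have hdist : dist z (z / ‖z‖) < δ := by
      have : z - z / ‖z‖ = (z / ‖z‖) * ((‖z‖ - 1 : ℝ) : ℂ) := by
        have : (‖z‖ : ℂ) ≠ 0 := Complex.ofReal_ne_zero.mpr hr.ne'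
        push_cast
        field_simp
      rw [dist_eq_norm, this, norm_mul, hunit, one_mul, Complex.norm_real, Real.norm_eq_abs]
      exact hclose.trans_le (min_le_left _ _)
    have h2 : z ∈ Metric.closedBall (0 : ℂ) 2 := by
      rw [mem_closedBall_zero_iff]
      linarith [(abs_lt.mp hclose).2]
    have h3 : z / ‖z‖ ∈ Metric.closedBall (0 : ℂ) 2 := by
      rw [mem_closedBall_zero_iff, hunit]
      norm_num
    have := hg z h2 _ h3 hdist
    rw [Real.dist_eq] at this
    have : 0 ≤ 2 * ‖g‖ / (η / 2) * |Real.log ‖z‖| := by positivity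
    linarith
  · have hlog : η / 2 ≤ |Real.log ‖z‖| := by
      rcases le_abs.mp (not_lt.mp hclose) with h | h
      · refine le_trans ?_ (le_abs_self _)
        refine le_trans ?_ (Real.one_sub_inv_le_log_of_pos hr)
        have : ‖z‖⁻¹ ≤ (1 + η)⁻¹ := inv_anti₀ (by positivity) (by linarith)
        have h4 : (1 + η)⁻¹ ≤ 1 - η / 2 := by
          rw [inv_le_iff_one_le_mul₀ (by positivity)]
          nlinarith
        linarith
      · refine le_trans ?_ (neg_le_abs _)
        linarith [Real.log_le_sub_one_of_pos hr]
    have hb : |g z - g (z / ‖z‖)| ≤ 2 * ‖g‖ := by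
      have := g.dist_le_two_norm z (z / ‖z‖)
      rwa [Real.dist_eq] at this
    calc _ ≤ 2 * ‖g‖ := hb
      _ = 2 * ‖g‖ / (η / 2) * (η / 2) := by field_simp
      _ ≤ 2 * ‖g‖ / (η / 2) * |Real.log ‖z‖| := by gcongr
      _ ≤ _ := le_add_of_nonneg_left hε.le

lemma integral_rootMeasure (P : Polynomial ℂ) {z : Fin P.natDegree → ℂ}
    (hz : P.roots = Finset.univ.val.map z) (g : ℂ →ᵇ ℝ) :
    ∫ w, g w ∂(rootMeasure P) = (P.natDegree : ℝ)⁻¹ * ∑ i, g (z i) := by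
  have hsum : (P.roots.map Measure.dirac).sum = ∑ i, Measure.dirac (z i) := by
    rw [hz, Multiset.map_map]
    rfl
  rw [rootMeasure, integral_smul_measure, hsum, integral_finsetSum_measure]
  · simp
  · intro i _
    exact g.integrable _

lemma integral_circleUniform (g : ℂ →ᵇ ℝ) :
    haveI : Fact (0 < 2 * Real.pi) := ⟨Real.two_pi_pos⟩
    ∫ w, g w ∂circleUniform =
      ∫ t : AddCircle (2 * Real.pi), g (AddCircle.toCircle t) ∂AddCircle.haarAddCircle := by
  have : Fact (0 < 2 * Real.pi) := ⟨Real.two_pi_pos⟩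
  rw [circleUniform, integral_smul_measure, AddCircle.integral_haarAddCircle,
    integral_map (by fun_prop) g.continuous.aestronglyMeasurable,
    ← AddCircle.integral_preimage (2 * Real.pi) 0, ENNReal.toReal_inv,
    ENNReal.toReal_ofReal Real.two_pi_pos.le, zero_add]
  simp [AddCircle.toCircle_apply_mk]

lemma div_norm_eq_exp_arg {z : ℂ} (hz : z ≠ 0) : z / ‖z‖ = Complex.exp (z.arg * Complex.I) := by
  rw [div_eq_iff (Complex.ofReal_ne_zero.mpr (norm_ne_zero_iff.mpr hz)), mul_comm,
    Complex.norm_mul_exp_arg_mul_I]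

lemma toCircle_arg {z : ℂ} (hz : z ≠ 0) :
    (AddCircle.toCircle (z.arg : AddCircle (2 * Real.pi)) : ℂ) = z / ‖z‖ := by
  rw [div_norm_eq_exp_arg hz]
  simp [AddCircle.toCircle_apply_mk]

lemma fourier_arg {z : ℂ} (hz : z ≠ 0) (k : ℕ) :
    fourier (k : ℤ) (z.arg : AddCircle (2 * Real.pi)) = (z / ‖z‖) ^ k := by
  rw [← toCircle_arg hz, fourier_apply, AddCircle.toCircle_zsmul]
  simp

/-- A form of the **Erdős-Turán equidistribution theorem**: if the heights of a sequence of complex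
polynomials grow subexponentially in the degree, their roots equidistribute on the unit circle. -/
theorem tendsto_integral_rootMeasure {P : ℕ → Polynomial ℂ}
    (h0 : ∀ᶠ n in atTop, (P n).coeff 0 ≠ 0)
    (hd : Tendsto (fun n => (P n).natDegree) atTop atTop)
    (hh : Tendsto (fun n => Real.log (P n).erdosTuranHeight / (P n).natDegree) atTop (nhds 0))
    (g : ℂ →ᵇ ℝ) :
    Tendsto (fun n => ∫ z, g z ∂(rootMeasure (P n))) atTop (nhds (∫ z, g z ∂circleUniform)) := by
  have : Fact (0 < 2 * Real.pi) := ⟨Real.two_pi_pos⟩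
  choose z hz using fun n => (P n).exists_roots_eq_map_fin
  have hdR : Tendsto (fun n => ((P n).natDegree : ℝ)) atTop atTop :=
    tendsto_natCast_atTop_atTop.comp hd
  have hd0 : ∀ᶠ n in atTop, (P n).natDegree ≠ 0 := hd.eventually_ne_atTop 0
  have hpow : ∀ k : ℕ, Tendsto (fun n => ((P n).natDegree : ℂ)⁻¹ *
      ∑ i, fourier ((k + 1 : ℕ) : ℤ) ((z n i).arg : AddCircle (2 * Real.pi))) atTop (nhds 0) := by
    intro k
    have hlim : Tendsto (fun n => ((k + 1) * 2 ^ (k + 2) : ℝ) *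
        (Real.log (P n).erdosTuranHeight / (P n).natDegree + ((P n).natDegree : ℝ)⁻¹))
        atTop (nhds 0) := by
      simpa using (hh.add hdR.inv_tendsto_atTop).const_mul ((k + 1) * 2 ^ (k + 2) : ℝ)
    refine squeeze_zero_norm' ?_ hlim
    filter_upwards [h0] with n hn
    simp_rw [fun i => fourier_arg (Polynomial.ne_zero_of_roots_eq_map hn (hz n) i) (k + 1)]
    rw [norm_mul, norm_inv, Complex.norm_natCast]
    calc _ ≤ ((P n).natDegree : ℝ)⁻¹ *
          ((k + 1) * 2 ^ (k + 2) * (Real.log (P n).erdosTuranHeight + 1)) := by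
            gcongr
            exact Polynomial.norm_sum_pow_normalized_roots_le hn (hz n) k
      _ = _ := by ring
  have hweyl := tendsto_avg_of_tendsto_avg_fourier
    (fun n i => ((z n i).arg : AddCircle (2 * Real.pi))) hd0 (fun k hk => by
      rcases Int.natAbs_eq k with hk' | hk'
      · obtain ⟨m, hm⟩ := Nat.exists_eq_succ_of_ne_zero (Int.natAbs_ne_zero.mpr hk)
        rw [hk', hm]
        exact hpow m
      · obtain ⟨m, hm⟩ := Nat.exists_eq_succ_of_ne_zero (Int.natAbs_ne_zero.mpr hk)
        rw [hk', hm]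
        have := (Complex.continuous_conj.tendsto 0).comp (hpow m)
        rw [map_zero] at this
        refine this.congr fun n => ?_
        simp only [Function.comp_apply, map_mul, map_inv₀, map_natCast, map_sum, fourier_neg])
    ⟨fun t => (g (AddCircle.toCircle t) : ℂ), by fun_prop⟩
  have hproj : Tendsto (fun n => ((P n).natDegree : ℝ)⁻¹ * ∑ i, g (z n i / ‖z n i‖)) atTop
      (nhds (∫ z, g z ∂circleUniform)) := by
    rw [integral_circleUniform]
    have hre := (Complex.continuous_re.tendsto _).comp hweyl
    simp only [ContinuousMap.coe_mk, integral_complex_ofReal, Complex.ofReal_re] at hre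
    refine hre.congr' ?_
    filter_upwards [h0] with n hn
    simp only [Function.comp_apply,
      fun i => toCircle_arg (Polynomial.ne_zero_of_roots_eq_map hn (hz n) i)]
    rw [← Complex.ofReal_sum, ← Complex.ofReal_natCast, ← Complex.ofReal_inv,
      ← Complex.ofReal_mul, Complex.ofReal_re]
  have hdiff : Tendsto (fun n => ((P n).natDegree : ℝ)⁻¹ * ∑ i, g (z n i) -
      ((P n).natDegree : ℝ)⁻¹ * ∑ i, g (z n i / ‖z n i‖)) atTop (nhds 0) := by
    rw [Metric.tendsto_nhds]
    intro ε hε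
    obtain ⟨C, hC0, hC⟩ := exists_abs_sub_div_norm_le g (half_pos hε)
    have hsmall : ∀ᶠ n in atTop,
        C * (Real.log (P n).erdosTuranHeight / (P n).natDegree) < ε / 2 := by
      have := hh.const_mul C
      rw [mul_zero] at this
      exact this.eventually_lt_const (half_pos hε)
    filter_upwards [h0, hd0, hsmall] with n hn hdn hs
    have hdpos : (0 : ℝ) < (P n).natDegree := by positivity
    rw [Real.dist_eq, sub_zero, ← mul_sub, ← sum_sub_distrib, abs_mul,
      abs_of_pos (inv_pos.mpr hdpos)]
    calc _ ≤ ((P n).natDegree : ℝ)⁻¹ * ∑ i, (ε / 2 + C * |Real.log ‖z n i‖|) := by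
          gcongr
          exact (abs_sum_le_sum_abs _ _).trans (sum_le_sum fun i _ =>
            hC _ (Polynomial.ne_zero_of_roots_eq_map hn (hz n) i))
      _ = ε / 2 + C * ((∑ i, |Real.log ‖z n i‖|) / (P n).natDegree) := by
          rw [sum_add_distrib, ← mul_sum, sum_const, card_univ, Fintype.card_fin, nsmul_eq_mul]
          field_simp
      _ ≤ ε / 2 + C * (Real.log (P n).erdosTuranHeight / (P n).natDegree) := by
          gcongr
          exact Polynomial.sum_abs_log_norm_roots_le hn (hz n)
      _ < ε := by linarith
  simp_rw [fun n => integral_rootMeasure (P n) (hz n) g]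
  simpa using hdiff.add hproj

lemma rankCount_pos {n : ℕ} (π : Nat.Partition n) : 0 < rankCount (partitionRank π) n :=
  Nat.card_pos_iff.mpr ⟨⟨⟨π, rfl⟩⟩, inferInstance⟩

lemma rankCount_sub_one_pos {n : ℕ} (hn : n ≠ 0) : 0 < rankCount ((n - 1 : ℕ) : ℤ) n := by
  have h := rankCount_pos (Nat.Partition.indiscrete n)
  rw [partitionRank, Nat.Partition.indiscrete_parts hn] at h
  convert h using 2
  simp
  omega

lemma rankCount_zero_pos {n : ℕ} (hn : 3 ≤ n) : 0 < rankCount 0 n := by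
  obtain ⟨k, rfl | rfl⟩ := n.even_or_odd'
  · have h := rankCount_pos (n := 2 * k)
      ⟨k ::ₘ 2 ::ₘ Multiset.replicate (k - 2) 1, by
        intro i hi
        simp only [Multiset.mem_cons, Multiset.mem_replicate] at hi
        omega, by simp; omega⟩
    convert h using 2
    have hsup : (Multiset.replicate (k - 2) 1).sup ≤ 1 :=
      Multiset.sup_le.mpr fun i hi => (Multiset.eq_of_mem_replicate hi).le
    simp only [partitionRank, Multiset.sup_cons, Multiset.card_cons, Multiset.card_replicate]
    omega
  · have h := rankCount_pos (n := 2 * k + 1)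
      ⟨(k + 1) ::ₘ Multiset.replicate k 1, by
        intro i hi
        simp only [Multiset.mem_cons, Multiset.mem_replicate] at hi
        omega, by simp; omega⟩
    convert h using 2
    have hsup : (Multiset.replicate k 1).sup ≤ 1 :=
      Multiset.sup_le.mpr fun i hi => (Multiset.eq_of_mem_replicate hi).le
    simp only [partitionRank, Multiset.sup_cons, Multiset.card_cons, Multiset.card_replicate]
    omega

lemma sum_rankCount_le (n : ℕ) (s : Finset ℕ) :
    ∑ m ∈ s, rankCount m n ≤ Fintype.card (Nat.Partition n) := by
  classical
  have h : ∀ m : ℕ, rankCount m n = #{π : Nat.Partition n | partitionRank π = m} := fun m => by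
    rw [rankCount, Nat.card_eq_fintype_card, Fintype.card_subtype]
  simp_rw [h]
  rw [← card_biUnion]
  · exact card_le_univ _
  · intro a _ b _ hab
    rw [Function.onFun, disjoint_left]
    intro π ha hb
    simp only [mem_filter, mem_univ, true_and] at ha hb
    exact hab (by exact_mod_cast ha.symm.trans hb)

lemma coeff_rankPrincipal (n m : ℕ) : (rankPrincipal n).coeff m =
    if m = 0 then (rankCount 0 n : ℂ) / 2 else if m < n then (rankCount m n : ℂ) else 0 := by
  rw [rankPrincipal, Polynomial.coeff_add, Polynomial.coeff_C, Polynomial.finsetSum_coeff]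
  simp only [Polynomial.coeff_C_mul_X_pow, sum_ite_eq, mem_Ico]
  rcases eq_or_ne m 0 with rfl | hm
  · simp
  · simp [hm, Nat.one_le_iff_ne_zero]

lemma natDegree_rankPrincipal {n : ℕ} (hn : 2 ≤ n) : (rankPrincipal n).natDegree = n - 1 := by
  refine le_antisymm ?_ ?_
  · rw [Polynomial.natDegree_le_iff_coeff_eq_zero]
    intro m hm
    rw [coeff_rankPrincipal, if_neg (by omega), if_neg (by omega)]
  · refine Polynomial.le_natDegree_of_ne_zero ?_
    rw [coeff_rankPrincipal, if_neg (by omega), if_pos (by omega)]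
    exact Nat.cast_ne_zero.mpr (rankCount_sub_one_pos (by omega)).ne'

lemma one_le_norm_leadingCoeff_rankPrincipal {n : ℕ} (hn : 2 ≤ n) :
    1 ≤ ‖(rankPrincipal n).leadingCoeff‖ := by
  rw [Polynomial.leadingCoeff, natDegree_rankPrincipal hn, coeff_rankPrincipal,
    if_neg (by omega), if_pos (by omega), Complex.norm_natCast]
  exact_mod_cast rankCount_sub_one_pos (by omega)

lemma half_le_norm_coeff_zero_rankPrincipal {n : ℕ} (hn : 3 ≤ n) :
    1 / 2 ≤ ‖(rankPrincipal n).coeff 0‖ := by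
  rw [coeff_rankPrincipal, if_pos rfl, norm_div, Complex.norm_natCast,
    Complex.norm_ofNat]
  have : (1 : ℝ) ≤ rankCount 0 n := by exact_mod_cast rankCount_zero_pos hn
  gcongr

lemma coeff_zero_rankPrincipal_ne_zero {n : ℕ} (hn : 3 ≤ n) : (rankPrincipal n).coeff 0 ≠ 0 :=
  norm_pos_iff.mp (one_half_pos.trans_le (half_le_norm_coeff_zero_rankPrincipal hn))

lemma sum_norm_coeff_rankPrincipal_le (n : ℕ) :
    ((rankPrincipal n).sum fun _ a => ‖a‖) ≤ Fintype.card (Nat.Partition n) := by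
  refine le_trans ?_ (Nat.cast_le.mpr (sum_rankCount_le n (rankPrincipal n).support))
  rw [Nat.cast_sum]
  refine sum_le_sum fun m _ => ?_
  rw [coeff_rankPrincipal]
  split_ifs with h0 h1
  · subst h0
    simp
  · simp
  · simp

lemma erdosTuranHeight_rankPrincipal_le {n : ℕ} (hn : 3 ≤ n) :
    (rankPrincipal n).erdosTuranHeight ≤ 2 * (Fintype.card (Nat.Partition n) : ℝ) ^ 2 := by
  have h1 := half_le_norm_coeff_zero_rankPrincipal hn
  have h2 := one_le_norm_leadingCoeff_rankPrincipal (n := n) (by omega)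
  have h3 := sum_norm_coeff_rankPrincipal_le n
  have h4 : 0 ≤ (rankPrincipal n).sum fun _ a => ‖a‖ := sum_nonneg fun _ _ => norm_nonneg _
  rw [Polynomial.erdosTuranHeight, div_le_iff₀ (by positivity)]
  have h5 : 1 / 2 ≤ ‖(rankPrincipal n).coeff 0‖ * ‖(rankPrincipal n).leadingCoeff‖ := by
    nlinarith
  calc _ ≤ (Fintype.card (Nat.Partition n) : ℝ) ^ 2 := by gcongr
    _ = 2 * (Fintype.card (Nat.Partition n) : ℝ) ^ 2 * (1 / 2) := by ring
    _ ≤ _ := by gcongr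

/-- Each variable `x ∈ (0, 1)` gives an upper bound on the number of partitions, by estimating
their generating function. -/
lemma card_partition_mul_pow_le (n : ℕ) {x : ℝ} (hx0 : 0 < x) (hx1 : x < 1) :
    (Fintype.card (Nat.Partition n) : ℝ) * x ^ n ≤ Real.exp (1 / (1 - x) ^ 2) := by
  classical
  have hsum : ∀ π : Nat.Partition n, ∑ i : Fin n, (i + 1) * π.parts.count (i + 1 : ℕ) = n := by
    intro π
    conv_rhs => rw [← π.parts_sum]
    rw [Finset.sum_multiset_count_of_subset (s := Finset.Icc 1 n)]
    · rw [Fin.sum_univ_eq_sum_range (fun i => (i + 1) * π.parts.count (i + 1)), range_eq_Ico,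
        Finset.sum_Ico_add' (fun i => i * π.parts.count i)]
      refine sum_congr (by ext; simp) fun i _ => by rw [smul_eq_mul, mul_comm]
    · intro i hi
      rw [Multiset.mem_toFinset] at hi
      exact mem_Icc.mpr ⟨π.parts_pos hi, Nat.Partition.le_of_mem_parts hi⟩
  let c : Nat.Partition n → Fin n → Fin (n + 1) := fun π i =>
    ⟨π.parts.count (i + 1 : ℕ), by
      have := single_le_sum (f := fun i : Fin n => (i + 1) * π.parts.count (i + 1 : ℕ))
        (fun _ _ => Nat.zero_le _) (mem_univ i)
      rw [hsum π] at this
      nlinarith [Nat.zero_le (i : ℕ)]⟩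
  have hc : Function.Injective c := by
    intro π σ h
    ext j
    by_cases hj : 1 ≤ j ∧ j ≤ n
    · have := congr_arg Fin.val (congr_fun h ⟨j - 1, by omega⟩)
      simpa [c, Nat.sub_add_cancel hj.1] using this
    · have : ∀ π : Nat.Partition n, j ∉ π.parts := fun π hp =>
        hj ⟨π.parts_pos hp, Nat.Partition.le_of_mem_parts hp⟩
      rw [Multiset.count_eq_zero_of_notMem (this π), Multiset.count_eq_zero_of_notMem (this σ)]
  have hy : 0 < 1 - x := by linarith
  have hfac : ∀ i : ℕ, ∑ j : Fin (n + 1), (x ^ (i + 1)) ^ (j : ℕ) ≤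
      Real.exp (x ^ i / (1 - x)) := by
    intro i
    have hq : x ^ (i + 1) ≤ x := by
      simpa using pow_le_pow_of_le_one hx0.le hx1.le (Nat.le_add_left 1 i)
    have hq0 : 0 < x ^ (i + 1) := pow_pos hx0 _
    rw [Fin.sum_univ_eq_sum_range (fun j => (x ^ (i + 1)) ^ j)]
    calc _ ≤ (1 - x ^ (i + 1))⁻¹ := by
          rw [← tsum_geometric_of_lt_one hq0.le (hq.trans_lt hx1)]
          exact (summable_geometric_of_lt_one hq0.le (hq.trans_lt hx1)).sum_le_tsum _
            fun _ _ => by positivity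
      _ = x ^ (i + 1) / (1 - x ^ (i + 1)) + 1 := by
          have : 1 - x ^ (i + 1) ≠ 0 := by linarith
          field_simp
          ring
      _ ≤ x ^ i / (1 - x) + 1 := by
          have : x ^ (i + 1) ≤ x ^ i := pow_le_pow_of_le_one hx0.le hx1.le (Nat.le_succ i)
          gcongr
      _ ≤ _ := Real.add_one_le_exp _
  calc (Fintype.card (Nat.Partition n) : ℝ) * x ^ n
      = ∑ π : Nat.Partition n, ∏ i : Fin n, (x ^ ((i : ℕ) + 1)) ^ (c π i : ℕ) := by
        simp_rw [← pow_mul, prod_pow_eq_pow_sum, c, hsum]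
        simp
    _ = ∑ f ∈ univ.map ⟨c, hc⟩, ∏ i : Fin n, (x ^ ((i : ℕ) + 1)) ^ (f i : ℕ) := by
        rw [sum_map]
        rfl
    _ ≤ ∑ f : Fin n → Fin (n + 1), ∏ i : Fin n, (x ^ ((i : ℕ) + 1)) ^ (f i : ℕ) :=
        sum_le_sum_of_subset_of_nonneg (subset_univ _) fun _ _ _ => by positivity
    _ = ∏ i : Fin n, ∑ j : Fin (n + 1), (x ^ ((i : ℕ) + 1)) ^ (j : ℕ) :=
        (Fintype.prod_sum fun (i : Fin n) (j : Fin (n + 1)) =>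
          (x ^ ((i : ℕ) + 1)) ^ (j : ℕ)).symm
    _ ≤ ∏ i : Fin n, Real.exp (x ^ (i : ℕ) / (1 - x)) :=
        prod_le_prod (fun _ _ => by positivity) fun i _ => hfac i
    _ ≤ Real.exp (1 / (1 - x) ^ 2) := by
        rw [← Real.exp_sum, Real.exp_le_exp, ← sum_div,
          Fin.sum_univ_eq_sum_range (fun i => x ^ i)]
        have : ∑ i ∈ range n, x ^ i ≤ (1 - x)⁻¹ := by
          rw [← tsum_geometric_of_lt_one hx0.le hx1]
          exact (summable_geometric_of_lt_one hx0.le hx1).sum_le_tsum _ fun _ _ => by positivity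
        calc _ ≤ (1 - x)⁻¹ / (1 - x) := by gcongr
          _ = _ := by field_simp

/-- The number of partitions of `n` grows subexponentially. -/
lemma tendsto_log_card_partition_div :
    Tendsto (fun n : ℕ => Real.log (Fintype.card (Nat.Partition n)) / n) atTop (nhds 0) := by
  rw [Metric.tendsto_nhds]
  intro ε hε
  set x := Real.exp (-(ε / 2))
  have hx1 : x < 1 := Real.exp_lt_one_iff.mpr (by linarith)
  set K := 1 / (1 - x) ^ 2
  filter_upwards [(tendsto_const_div_atTop_nhds_zero_nat K).eventually_lt_const (half_pos hε),
    eventually_gt_atTop 0] with n hn hn0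
  have hcard : (1 : ℝ) ≤ Fintype.card (Nat.Partition n) := by
    exact_mod_cast Fintype.card_pos
  have hn0' : (0 : ℝ) < n := by exact_mod_cast hn0
  have h := Real.log_le_log (by positivity)
    (card_partition_mul_pow_le n (Real.exp_pos (-(ε / 2))) hx1)
  rw [Real.log_mul (by positivity) (by positivity), Real.log_pow, Real.log_exp, Real.log_exp] at h
  rw [Real.dist_eq, sub_zero, abs_of_nonneg (div_nonneg (Real.log_nonneg hcard) hn0'.le),
    div_lt_iff₀ hn0']
  rw [div_lt_iff₀ hn0'] at hn
  change _ ≤ K at h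
  linarith

lemma tendsto_log_erdosTuranHeight_rankPrincipal_div :
    Tendsto (fun n => Real.log (rankPrincipal n).erdosTuranHeight / (rankPrincipal n).natDegree)
      atTop (nhds 0) := by
  have hlim : Tendsto (fun n : ℕ => 2 * (Real.log 2 / n +
      2 * (Real.log (Fintype.card (Nat.Partition n)) / n))) atTop (nhds 0) := by
    simpa using ((tendsto_const_div_atTop_nhds_zero_nat (Real.log 2)).add
      (tendsto_log_card_partition_div.const_mul 2)).const_mul 2
  refine squeeze_zero' ?_ ?_ hlim
  · filter_upwards [eventually_ge_atTop 3] with n hn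
    have h0 := coeff_zero_rankPrincipal_ne_zero hn
    exact div_nonneg (Polynomial.log_erdosTuranHeight_nonneg h0) (Nat.cast_nonneg _)
  · filter_upwards [eventually_ge_atTop 3] with n hn
    have h0 := coeff_zero_rankPrincipal_ne_zero hn
    have hcard : (1 : ℝ) ≤ Fintype.card (Nat.Partition n) := by
      exact_mod_cast Fintype.card_pos
    have hlog := Real.log_le_log (Polynomial.erdosTuranHeight_pos h0)
      (erdosTuranHeight_rankPrincipal_le hn)
    rw [Real.log_mul two_ne_zero (by positivity), Real.log_pow] at hlog
    have hn3 : (3 : ℝ) ≤ n := by exact_mod_cast hn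
    have hnum : 0 ≤ Real.log 2 + 2 * Real.log (Fintype.card (Nat.Partition n)) :=
      add_nonneg (Real.log_nonneg one_le_two) (mul_nonneg two_pos.le (Real.log_nonneg hcard))
    rw [natDegree_rankPrincipal (by omega), Nat.cast_sub (by omega), Nat.cast_one]
    calc _ ≤ (Real.log 2 + 2 * Real.log (Fintype.card (Nat.Partition n))) / (n / 2) := by
          push_cast at hlog
          gcongr
          linarith
      _ = _ := by ring

/-- **Theorem 4.2 (rank part):** as `n → ∞`, the empirical root measures of the rank
principal polynomials `N_n(w)` converge weakly to the uniform probability measure on the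
unit circle. -/
theorem rankPrincipal_roots_equidistribute :
    ∀ g : BoundedContinuousFunction ℂ ℝ,
      Tendsto (fun n : ℕ => ∫ z, g z ∂(rootMeasure (rankPrincipal n))) atTop
        (nhds (∫ z, g z ∂circleUniform)) := by
  refine tendsto_integral_rootMeasure ?_ ?_ ?_
  · filter_upwards [eventually_ge_atTop 3] with n hn
    exact coeff_zero_rankPrincipal_ne_zero hn
  · refine (tendsto_sub_atTop_nat 1).congr' ?_
    filter_upwards [eventually_ge_atTop 2] with n hn
    exact (natDegree_rankPrincipal hn).symm
  · exact tendsto_log_erdosTuranHeight_rankPrincipal_div
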